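/- Let f : {density matrices in M_d(ℂ)} → [0,∞) be unitarily invariant (f(UρU†) = f(ρ) for every unitary U) and concave, and define F_pure(ψ) = f(Diag(λ(ψ))) on pure states ψ, where Diag(λ(ψ)) is the diagonal density matrix with entries |ψ_n|². Then the convex-roof extension F of F_pure is an ensemble monotone for all states: for every density matrix ρ ∈ M_d(ℂ), every finite family {K_j}_{j∈J} of number-shift Kraus operators with Σ_{j∈J} K_j†K_j = I, and every partition J = ⊔_{x∈X} J_x, setting p_x = Σ_{j∈J_x} Tr(K_j ρ K_j†) and σ_x = (1/p_x) Σ_{j∈J_x} K_j ρ K_j† for p_x > 0, one has F(ρ) ≥ Σ_{x : p_x>0} p_x F(σ_x). -/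

import Mathlib

open Matrix Finset
open scoped ComplexOrder

noncomputable section

/-- Squared Euclidean norm of a vector in `ℂ^d`. -/
def nsq {d : ℕ} (ψ : Fin d → ℂ) : ℝ := ∑ n, ‖ψ n‖ ^ 2

/-- The rank-one projector `|ψ⟩⟨ψ|`, with entries `ψ m * conj (ψ n)`. -/
def pureProj {d : ℕ} (ψ : Fin d → ℂ) : Matrix (Fin d) (Fin d) ℂ :=
  Matrix.vecMulVec ψ (star ψ)

/-- A density matrix: positive semidefinite with trace one. -/
def IsDensityMatrix {d : ℕ} (ρ : Matrix (Fin d) (Fin d) ℂ) : Prop :=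
  ρ.PosSemidef ∧ ρ.trace = 1

/-- Convex-roof extension of a function defined on pure states (unit vectors). -/
def convexRoof {d : ℕ} (Fpure : (Fin d → ℂ) → ℝ) (ρ : Matrix (Fin d) (Fin d) ℂ) : ℝ :=
  sInf { r : ℝ | ∃ (m : ℕ) (q : Fin m → ℝ) (ψ : Fin m → Fin d → ℂ),
    (∀ i, 0 ≤ q i) ∧ (∑ i, q i = 1) ∧ (∀ i, nsq (ψ i) = 1) ∧
    ρ = ∑ i, q i • pureProj (ψ i) ∧ r = ∑ i, q i * Fpure (ψ i) }

/-- A number-shift Kraus operator: for some `ℓ : ℤ`, `K m n = 0` unless `m = n + ℓ`. -/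
def IsNumberShift {d : ℕ} (K : Matrix (Fin d) (Fin d) ℂ) : Prop :=
  ∃ ℓ : ℤ, ∀ m n : Fin d, (m : ℤ) ≠ (n : ℤ) + ℓ → K m n = 0

/-- `Fpure` is a pure-state ensemble monotone under U(1)-invariant operations:
for every unit vector `ψ` and every finite family of number-shift Kraus operators
`{K x}` with `∑ x, (K x)ᴴ * K x = 1`, the average of `Fpure` over the (normalized)
outcomes with positive probability does not exceed `Fpure ψ`. -/
def IsPureEnsembleMonotone {d : ℕ} (Fpure : (Fin d → ℂ) → ℝ) : Prop :=
  ∀ (ψ : Fin d → ℂ), nsq ψ = 1 →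
    ∀ (m : ℕ) (K : Fin m → Matrix (Fin d) (Fin d) ℂ),
      (∀ x, IsNumberShift (K x)) →
      (∑ x, (K x)ᴴ * K x = 1) →
      Fpure ψ ≥
        ∑ x ∈ Finset.univ.filter (fun x => 0 < nsq ((K x).mulVec ψ)),
          nsq ((K x).mulVec ψ) *
            Fpure ((Real.sqrt (nsq ((K x).mulVec ψ)))⁻¹ • (K x).mulVec ψ)

/-- The probability `p_x = ∑_{j ∈ J_x} Tr(K_j ρ K_j†)` of the coarse-grained outcome `x`,
where `J_x` is the fiber of the partition map `part` over `x`. -/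
def outProb {d mJ mX : ℕ} (K : Fin mJ → Matrix (Fin d) (Fin d) ℂ)
    (part : Fin mJ → Fin mX) (ρ : Matrix (Fin d) (Fin d) ℂ) (x : Fin mX) : ℝ :=
  ∑ j ∈ Finset.univ.filter (fun j => part j = x), ((K j * ρ * (K j)ᴴ).trace).re

/-- The normalized output state `σ_x = p_x⁻¹ ∑_{j ∈ J_x} K_j ρ K_j†`. -/
def outState {d mJ mX : ℕ} (K : Fin mJ → Matrix (Fin d) (Fin d) ℂ)
    (part : Fin mJ → Fin mX) (ρ : Matrix (Fin d) (Fin d) ℂ) (x : Fin mX) :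
    Matrix (Fin d) (Fin d) ℂ :=
  (outProb K part ρ x)⁻¹ •
    ∑ j ∈ Finset.univ.filter (fun j => part j = x), K j * ρ * (K j)ᴴ

/-- The diagonal density matrix with entries `|ψ_n|²` (the twirl of `|ψ⟩⟨ψ|`). -/
def diagOf {d : ℕ} (ψ : Fin d → ℂ) : Matrix (Fin d) (Fin d) ℂ :=
  Matrix.diagonal fun n => ((‖ψ n‖ ^ 2 : ℝ) : ℂ)

lemma nsq_nonneg {d : ℕ} (ψ : Fin d → ℂ) : 0 ≤ nsq ψ :=
  Finset.sum_nonneg fun _ _ => sq_nonneg _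

lemma nsq_smul {d : ℕ} (c : ℝ) (ψ : Fin d → ℂ) : nsq (c • ψ) = c ^ 2 * nsq ψ := by
  simp [nsq, Finset.mul_sum, mul_pow]

lemma pureProj_smul {d : ℕ} (c : ℝ) (ψ : Fin d → ℂ) :
    pureProj (c • ψ) = (c ^ 2) • pureProj ψ := by
  ext i j
  simp [pureProj, Matrix.vecMulVec_apply]
  ring

lemma trace_pureProj {d : ℕ} (ψ : Fin d → ℂ) : (pureProj ψ).trace = (nsq ψ : ℂ) := by
  simp [pureProj, nsq, Matrix.trace, Matrix.vecMulVec_apply, Complex.mul_conj,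
    Complex.normSq_eq_norm_sq]

lemma mul_pureProj_mul_conjTranspose {d : ℕ} (A : Matrix (Fin d) (Fin d) ℂ) (ψ : Fin d → ℂ) :
    A * pureProj ψ * Aᴴ = pureProj (A *ᵥ ψ) := by
  rw [pureProj, pureProj, Matrix.mul_vecMulVec, Matrix.vecMulVec_mul, Matrix.star_mulVec]

lemma pureProj_eq_zero_of_nsq_eq_zero {d : ℕ} {ψ : Fin d → ℂ} (h : nsq ψ = 0) :
    pureProj ψ = 0 := by
  have hz : ψ = 0 := by
    funext n
    have := (Finset.sum_eq_zero_iff_of_nonneg (fun i _ => sq_nonneg ‖ψ i‖)).1 h n (mem_univ n)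
    simpa using this
  simp [hz, pureProj]

lemma nsq_normalize {d : ℕ} {ψ : Fin d → ℂ} (h : nsq ψ ≠ 0) :
    nsq ((Real.sqrt (nsq ψ))⁻¹ • ψ) = 1 := by
  rw [nsq_smul, inv_pow, Real.sq_sqrt (nsq_nonneg ψ), inv_mul_cancel₀ h]

lemma nsq_smul_pureProj_normalize {d : ℕ} {ψ : Fin d → ℂ} (h : nsq ψ ≠ 0) :
    nsq ψ • pureProj ((Real.sqrt (nsq ψ))⁻¹ • ψ) = pureProj ψ := by
  rw [pureProj_smul, inv_pow, Real.sq_sqrt (nsq_nonneg ψ), smul_smul, mul_inv_cancel₀ h, one_smul]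

/-- The values over which the infimum in `convexRoof` is taken. -/
def roofValues {d : ℕ} (Fpure : (Fin d → ℂ) → ℝ) (ρ : Matrix (Fin d) (Fin d) ℂ) : Set ℝ :=
  { r : ℝ | ∃ (m : ℕ) (q : Fin m → ℝ) (ψ : Fin m → Fin d → ℂ),
    (∀ i, 0 ≤ q i) ∧ (∑ i, q i = 1) ∧ (∀ i, nsq (ψ i) = 1) ∧
    ρ = ∑ i, q i • pureProj (ψ i) ∧ r = ∑ i, q i * Fpure (ψ i) }

/-- A decomposition into unnormalised pure states yields a value of the convex roof. -/
lemma sum_nsq_mul_mem_roofValues {d : ℕ} {ι : Type*} (Fpure : (Fin d → ℂ) → ℝ) (s : Finset ι)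
    (φ : ι → Fin d → ℂ) (hφ : ∑ i ∈ s, nsq (φ i) = 1) :
    ∑ i ∈ s, nsq (φ i) * Fpure ((Real.sqrt (nsq (φ i)))⁻¹ • φ i) ∈
      roofValues Fpure (∑ i ∈ s, pureProj (φ i)) := by
  classical
  set t := s.filter fun i => nsq (φ i) ≠ 0 with ht
  have hmem : ∀ k : Fin t.card, nsq (φ (t.equivFin.symm k)) ≠ 0 := fun k =>
    (Finset.mem_filter.1 (t.equivFin.symm k).2).2
  have reindex : ∀ {M : Type} [AddCommMonoid M] (g : ι → M),
      (∀ i, nsq (φ i) = 0 → g i = 0) →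
      ∑ i ∈ s, g i = ∑ k : Fin t.card, g (t.equivFin.symm k) := by
    intro M _ g hg
    rw [Equiv.sum_comp t.equivFin.symm fun i : t => g i, Finset.sum_coe_sort t g, ht,
      Finset.sum_filter_of_ne]
    exact fun i _ hi h0 => hi (hg i h0)
  refine ⟨t.card, fun k => nsq (φ (t.equivFin.symm k)),
    fun k => (Real.sqrt (nsq (φ (t.equivFin.symm k))))⁻¹ • φ (t.equivFin.symm k),
    fun k => nsq_nonneg _, ?_, fun k => nsq_normalize (hmem k), ?_, ?_⟩
  · rw [← hφ, reindex (fun i => nsq (φ i)) fun i h => h]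
  · rw [reindex (fun i => pureProj (φ i)) fun i h => pureProj_eq_zero_of_nsq_eq_zero h]
    exact Finset.sum_congr rfl fun k _ => (nsq_smul_pureProj_normalize (hmem k)).symm
  · exact reindex (fun i => nsq (φ i) * Fpure ((Real.sqrt (nsq (φ i)))⁻¹ • φ i))
      fun i h => by simp [h]

lemma roofValues_nonempty {d : ℕ} (Fpure : (Fin d → ℂ) → ℝ) {ρ : Matrix (Fin d) (Fin d) ℂ}
    (hρ : IsDensityMatrix ρ) : (roofValues Fpure ρ).Nonempty := by
  obtain ⟨m, v, hv⟩ := Matrix.posSemidef_iff_eq_sum_vecMulVec.1 hρ.1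
  have hv' : ρ = ∑ i, pureProj (v i) := hv
  have htr := hρ.2
  rw [hv', Matrix.trace_sum] at htr
  simp_rw [trace_pureProj] at htr
  rw [hv']
  exact ⟨_, sum_nsq_mul_mem_roofValues Fpure univ v (by exact_mod_cast htr)⟩

lemma roofValues_bddBelow {d : ℕ} {Fpure : (Fin d → ℂ) → ℝ}
    (hF : ∀ ψ, nsq ψ = 1 → 0 ≤ Fpure ψ) (ρ : Matrix (Fin d) (Fin d) ℂ) :
    BddBelow (roofValues Fpure ρ) := by
  refine ⟨0, ?_⟩
  rintro r ⟨m, q, ψ, hq, -, hψ, -, rfl⟩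
  exact Finset.sum_nonneg fun i _ => mul_nonneg (hq i) (hF _ (hψ i))

lemma isDensityMatrix_diagonal {d : ℕ} {v : Fin d → ℝ} (hv : 0 ≤ v) (hs : ∑ n, v n = 1) :
    IsDensityMatrix (Matrix.diagonal fun n => (v n : ℂ)) := by
  refine ⟨Matrix.PosSemidef.diagonal fun n => ?_, ?_⟩
  · simpa using hv n
  · rw [Matrix.trace_diagonal]
    exact_mod_cast hs

/-- The degree-one homogeneous extension of `f ∘ Diag` from probability vectors to nonnegative
vectors. -/
def diagPerspective {d : ℕ} (f : Matrix (Fin d) (Fin d) ℂ → ℝ) (v : Fin d → ℝ) : ℝ :=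
  (∑ n, v n) * f (Matrix.diagonal fun n => (((∑ k, v k)⁻¹ * v n : ℝ) : ℂ))

lemma isDensityMatrix_normalize {d : ℕ} {v : Fin d → ℝ} (hv : 0 ≤ v) (hs : ∑ n, v n ≠ 0) :
    IsDensityMatrix (Matrix.diagonal fun n => (((∑ k, v k)⁻¹ * v n : ℝ) : ℂ)) :=
  isDensityMatrix_diagonal
    (fun n => mul_nonneg (inv_nonneg.2 (Finset.sum_nonneg fun k _ => hv k)) (hv n))
    (by rw [← Finset.mul_sum, inv_mul_cancel₀ hs])

lemma diagPerspective_nonneg {d : ℕ} {f : Matrix (Fin d) (Fin d) ℂ → ℝ}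
    (hf0 : ∀ ρ, IsDensityMatrix ρ → 0 ≤ f ρ) {v : Fin d → ℝ} (hv : 0 ≤ v) :
    0 ≤ diagPerspective f v := by
  by_cases hs : ∑ n, v n = 0
  · simp [diagPerspective, hs]
  · exact mul_nonneg (Finset.sum_nonneg fun k _ => hv k)
      (hf0 _ (isDensityMatrix_normalize hv hs))

lemma diagPerspective_smul {d : ℕ} (f : Matrix (Fin d) (Fin d) ℂ → ℝ) (c : ℝ) (v : Fin d → ℝ) :
    diagPerspective f (c • v) = c * diagPerspective f v := by
  rcases eq_or_ne c 0 with rfl | hc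
  · simp [diagPerspective]
  · have h : ∀ n, (c * ∑ k, v k)⁻¹ * (c * v n) = (∑ k, v k)⁻¹ * v n := fun n => by
      rw [mul_inv, mul_mul_mul_comm, inv_mul_cancel₀ hc, one_mul]
    simp only [diagPerspective, Pi.smul_apply, smul_eq_mul, ← Finset.mul_sum, h, mul_assoc]

lemma diagPerspective_comp_perm {d : ℕ} {f : Matrix (Fin d) (Fin d) ℂ → ℝ}
    (hinv : ∀ ρ, IsDensityMatrix ρ → ∀ U ∈ Matrix.unitaryGroup (Fin d) ℂ,
      f (U * ρ * Uᴴ) = f ρ)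
    {v : Fin d → ℝ} (hv : 0 ≤ v) (σ : Equiv.Perm (Fin d)) :
    diagPerspective f (v ∘ σ) = diagPerspective f v := by
  have hsum : ∑ n, (v ∘ σ) n = ∑ n, v n := Equiv.sum_comp σ v
  by_cases hs : ∑ n, v n = 0
  · rw [diagPerspective, diagPerspective, hsum, hs, zero_mul, zero_mul]
  have hU : σ.permMatrix ℂ ∈ Matrix.unitaryGroup (Fin d) ℂ := by
    rw [Matrix.mem_unitaryGroup_iff, Matrix.star_eq_conjTranspose,
      Matrix.conjTranspose_permMatrix, ← Matrix.permMatrix_mul]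
    simp
  unfold diagPerspective
  rw [hsum, ← hinv _ (isDensityMatrix_normalize hv hs) _ hU]
  congr 2
  rw [Matrix.conjTranspose_permMatrix, PEquiv.toMatrix_toPEquiv_mul,
    PEquiv.mul_toMatrix_toPEquiv, Matrix.submatrix_submatrix]
  exact (Matrix.submatrix_diagonal_equiv
    (fun n => (((∑ k, v k)⁻¹ * v n : ℝ) : ℂ)) σ).symm

lemma diagPerspective_add_le {d : ℕ} {f : Matrix (Fin d) (Fin d) ℂ → ℝ}
    (hconc : ∀ ρ₁ ρ₂, IsDensityMatrix ρ₁ → IsDensityMatrix ρ₂ →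
      ∀ t : ℝ, 0 ≤ t → t ≤ 1 →
        t * f ρ₁ + (1 - t) * f ρ₂ ≤ f (t • ρ₁ + (1 - t) • ρ₂))
    {u v : Fin d → ℝ} (hu : 0 ≤ u) (hv : 0 ≤ v) :
    diagPerspective f u + diagPerspective f v ≤ diagPerspective f (u + v) := by
  have vanish : ∀ {w : Fin d → ℝ}, 0 ≤ w → ∑ n, w n = 0 → w = 0 := fun {w} hw hs =>
    funext fun n => (Finset.sum_eq_zero_iff_of_nonneg fun i _ => hw i).1 hs n (mem_univ n)
  have hzero : diagPerspective f 0 = 0 := by simp [diagPerspective]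
  by_cases hsu : ∑ n, u n = 0
  · simp [vanish hu hsu, hzero]
  by_cases hsv : ∑ n, v n = 0
  · simp [vanish hv hsv, hzero]
  have hu0 : 0 < ∑ n, u n := lt_of_le_of_ne (Finset.sum_nonneg fun i _ => hu i) (Ne.symm hsu)
  have hv0 : 0 < ∑ n, v n := lt_of_le_of_ne (Finset.sum_nonneg fun i _ => hv i) (Ne.symm hsv)
  have key := hconc _ _ (isDensityMatrix_normalize hu hsu) (isDensityMatrix_normalize hv hsv)
    ((∑ n, u n) / (∑ n, u n + ∑ n, v n)) (by positivity)
    ((div_le_one (by positivity)).2 (by linarith))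
  unfold diagPerspective
  have hadd : ∑ n, (u + v) n = ∑ n, u n + ∑ n, v n := Finset.sum_add_distrib
  rw [hadd]
  generalize ∑ n, u n = a at *
  generalize ∑ n, v n = b at *
  have hmat : (a / (a + b)) • Matrix.diagonal (fun n => ((a⁻¹ * u n : ℝ) : ℂ)) +
      (1 - a / (a + b)) • Matrix.diagonal (fun n => ((b⁻¹ * v n : ℝ) : ℂ)) =
      Matrix.diagonal fun n => (((a + b)⁻¹ * (u + v) n : ℝ) : ℂ) := by
    rw [← Matrix.diagonal_smul, ← Matrix.diagonal_smul, Matrix.diagonal_add]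
    congr 1
    funext n
    simp only [Pi.smul_apply, Complex.real_smul, Pi.add_apply, ← Complex.ofReal_mul,
      ← Complex.ofReal_add]
    congr 1
    field_simp
    ring
  rw [hmat] at key
  have := mul_le_mul_of_nonneg_left key (add_pos hu0 hv0).le
  refine le_trans (le_of_eq ?_) this
  field_simp
  ring

lemma sum_diagPerspective_le {d : ℕ} {ι : Type*} {f : Matrix (Fin d) (Fin d) ℂ → ℝ}
    (hconc : ∀ ρ₁ ρ₂, IsDensityMatrix ρ₁ → IsDensityMatrix ρ₂ →
      ∀ t : ℝ, 0 ≤ t → t ≤ 1 →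
        t * f ρ₁ + (1 - t) * f ρ₂ ≤ f (t • ρ₁ + (1 - t) • ρ₂))
    (s : Finset ι) {v : ι → Fin d → ℝ} (hv : ∀ i, 0 ≤ v i) :
    ∑ i ∈ s, diagPerspective f (v i) ≤ diagPerspective f (∑ i ∈ s, v i) := by
  classical
  induction s using Finset.induction_on with
  | empty => simp [diagPerspective]
  | insert a s ha ih =>
    rw [Finset.sum_insert ha, Finset.sum_insert ha]
    exact (add_le_add_right ih _).trans
      (diagPerspective_add_le hconc (hv a) (Finset.sum_nonneg fun i _ => hv i))

/-- The unnormalised distribution of a vector in the number basis. -/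
def population {d : ℕ} (ψ : Fin d → ℂ) : Fin d → ℝ := fun n => ‖ψ n‖ ^ 2

lemma population_nonneg {d : ℕ} (ψ : Fin d → ℂ) : 0 ≤ population ψ := fun _ => sq_nonneg _

lemma population_smul {d : ℕ} (c : ℝ) (ψ : Fin d → ℂ) :
    population (c • ψ) = c ^ 2 • population ψ := by
  funext n
  simp [population, mul_pow]

lemma nsq_mul_diagOf_normalize {d : ℕ} (f : Matrix (Fin d) (Fin d) ℂ → ℝ) (ψ : Fin d → ℂ) :
    nsq ψ * f (diagOf ((Real.sqrt (nsq ψ))⁻¹ • ψ)) = diagPerspective f (population ψ) := by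
  change nsq ψ * f (Matrix.diagonal fun n =>
    ((population ((Real.sqrt (nsq ψ))⁻¹ • ψ) n : ℝ) : ℂ)) = _
  rw [population_smul, inv_pow, Real.sq_sqrt (nsq_nonneg ψ)]
  rfl

lemma diagPerspective_population_of_nsq_eq_one {d : ℕ} (f : Matrix (Fin d) (Fin d) ℂ → ℝ)
    {ψ : Fin d → ℂ} (hψ : nsq ψ = 1) : diagPerspective f (population ψ) = f (diagOf ψ) := by
  rw [← nsq_mul_diagOf_normalize, hψ]
  simp

/-- A number-shift operator has, after a cyclic relabelling of rows, only diagonal entries. -/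
lemma IsNumberShift.exists_perm {d : ℕ} {A : Matrix (Fin d) (Fin d) ℂ} (hA : IsNumberShift A) :
    ∃ σ : Equiv.Perm (Fin d), ∀ m n, m ≠ σ n → A m n = 0 := by
  obtain ⟨l, hl⟩ := hA
  cases d with
  | zero => exact ⟨1, fun m => m.elim0⟩
  | succ k =>
    have hpos : (0 : ℤ) < ((k : ℤ) + 1) := by positivity
    have hlt : (l % ((k : ℤ) + 1)).toNat < k + 1 := by
      have := Int.emod_nonneg l hpos.ne'
      have := Int.emod_lt_of_pos l hpos
      omega
    refine ⟨Equiv.addRight (⟨_, hlt⟩ : Fin (k + 1)), fun m n hmn => hl m n fun h => hmn ?_⟩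
    apply Fin.ext
    rw [Equiv.coe_addRight, Fin.val_add]
    zify
    rw [Int.toNat_of_nonneg (Int.emod_nonneg l hpos.ne'), Int.add_emod_emod, ← h]
    exact (Int.emod_eq_of_lt (by positivity) (by exact_mod_cast m.2)).symm

lemma sum_norm_sq_col_eq_one {d m : ℕ} {A : Fin m → Matrix (Fin d) (Fin d) ℂ}
    (hA : ∑ j, (A j)ᴴ * A j = 1) (n : Fin d) : ∑ j, ∑ i, ‖A j i n‖ ^ 2 = 1 := by
  have h := congrFun (congrFun hA n) n
  simp only [Matrix.sum_apply, Matrix.mul_apply, Matrix.conjTranspose_apply,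
    Matrix.one_apply_eq, Complex.star_def, Complex.conj_mul'] at h
  exact_mod_cast h

/-- Pure-state ensemble monotonicity, in homogeneous form. -/
lemma sum_diagPerspective_mulVec_le {d m : ℕ} {f : Matrix (Fin d) (Fin d) ℂ → ℝ}
    (hinv : ∀ ρ, IsDensityMatrix ρ → ∀ U ∈ Matrix.unitaryGroup (Fin d) ℂ,
      f (U * ρ * Uᴴ) = f ρ)
    (hconc : ∀ ρ₁ ρ₂, IsDensityMatrix ρ₁ → IsDensityMatrix ρ₂ →
      ∀ t : ℝ, 0 ≤ t → t ≤ 1 →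
        t * f ρ₁ + (1 - t) * f ρ₂ ≤ f (t • ρ₁ + (1 - t) • ρ₂))
    {A : Fin m → Matrix (Fin d) (Fin d) ℂ} (hA : ∀ j, IsNumberShift (A j))
    (hsum : ∑ j, (A j)ᴴ * A j = 1) (ψ : Fin d → ℂ) :
    ∑ j, diagPerspective f (population (A j *ᵥ ψ)) ≤ diagPerspective f (population ψ) := by
  choose σ hσ using fun j => (hA j).exists_perm
  have hcol : ∀ n, ∑ j, ‖A j (σ j n) n‖ ^ 2 = 1 := fun n => by
    rw [← sum_norm_sq_col_eq_one hsum n]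
    refine Finset.sum_congr rfl fun j _ => ?_
    rw [Fintype.sum_eq_single (σ j n) fun i hi => by simp [hσ j i n hi]]
  have hrow : ∀ j n, (A j *ᵥ ψ) (σ j n) = A j (σ j n) n * ψ n := fun j n => by
    rw [Matrix.mulVec, dotProduct, Fintype.sum_eq_single n]
    intro k hk
    rw [hσ j (σ j n) k fun h => hk ((σ j).injective h.symm), zero_mul]
  have hpop : ∑ j, population (A j *ᵥ ψ) ∘ σ j = population ψ := by
    funext n
    simp only [Finset.sum_apply, Function.comp_apply, population, hrow, norm_mul, mul_pow]
    rw [← Finset.sum_mul, hcol, one_mul]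
  calc ∑ j, diagPerspective f (population (A j *ᵥ ψ))
      = ∑ j, diagPerspective f (population (A j *ᵥ ψ) ∘ σ j) :=
        Finset.sum_congr rfl fun j _ => by
          rw [diagPerspective_comp_perm hinv (population_nonneg _) (σ j)]
    _ ≤ diagPerspective f (∑ j, population (A j *ᵥ ψ) ∘ σ j) :=
        sum_diagPerspective_le hconc univ (v := fun j => population (A j *ᵥ ψ) ∘ σ j)
          fun j n => population_nonneg (A j *ᵥ ψ) (σ j n)
    _ = diagPerspective f (population ψ) := by rw [hpop]

lemma outProb_sum_pureProj {d mJ mX m : ℕ} (K : Fin mJ → Matrix (Fin d) (Fin d) ℂ)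
    (part : Fin mJ → Fin mX) (q : Fin m → ℝ) (ψ : Fin m → Fin d → ℂ) (x : Fin mX) :
    outProb K part (∑ i, q i • pureProj (ψ i)) x =
      ∑ j ∈ univ.filter (fun j => part j = x), ∑ i, q i * nsq (K j *ᵥ ψ i) := by
  refine Finset.sum_congr rfl fun j _ => ?_
  simp [Finset.mul_sum, Finset.sum_mul, Matrix.trace_sum, mul_pureProj_mul_conjTranspose,
    trace_pureProj]

/-- The convex roof of a post-measurement state is bounded by the average over the ensemble
obtained by applying the Kraus operators to a decomposition of the input. -/
lemma outProb_mul_convexRoof_outState_le {d mJ mX m : ℕ} {f : Matrix (Fin d) (Fin d) ℂ → ℝ}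
    (hf0 : ∀ ρ, IsDensityMatrix ρ → 0 ≤ f ρ) (K : Fin mJ → Matrix (Fin d) (Fin d) ℂ)
    (part : Fin mJ → Fin mX) {q : Fin m → ℝ} (hq : ∀ i, 0 ≤ q i) (ψ : Fin m → Fin d → ℂ)
    {x : Fin mX} (hx : 0 < outProb K part (∑ i, q i • pureProj (ψ i)) x) :
    outProb K part (∑ i, q i • pureProj (ψ i)) x *
        convexRoof (fun ψ => f (diagOf ψ)) (outState K part (∑ i, q i • pureProj (ψ i)) x) ≤
      ∑ j ∈ univ.filter (fun j => part j = x),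
        ∑ i, q i * diagPerspective f (population (K j *ᵥ ψ i)) := by
  set p := outProb K part (∑ i, q i • pureProj (ψ i)) x with hp
  set s := univ.filter (fun j => part j = x) with hs
  let φ : Fin mJ × Fin m → Fin d → ℂ := fun z => Real.sqrt (p⁻¹ * q z.2) • (K z.1 *ᵥ ψ z.2)
  have hsq : ∀ i, Real.sqrt (p⁻¹ * q i) ^ 2 = p⁻¹ * q i := fun i =>
    Real.sq_sqrt (mul_nonneg (inv_nonneg.2 hx.le) (hq i))
  have hnorm : ∑ z ∈ s ×ˢ univ, nsq (φ z) = 1 := by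
    simp only [φ, nsq_smul, hsq, Finset.sum_product, mul_assoc, ← Finset.mul_sum]
    rw [← outProb_sum_pureProj, ← hp, inv_mul_cancel₀ hx.ne']
  have hstate : outState K part (∑ i, q i • pureProj (ψ i)) x =
      ∑ z ∈ s ×ˢ univ, pureProj (φ z) := by
    simp only [φ, pureProj_smul, hsq, Finset.sum_product, mul_smul, ← Finset.smul_sum]
    rw [outState, ← hp]
    congr 1
    refine Finset.sum_congr rfl fun j _ => ?_
    simp [Finset.mul_sum, Finset.sum_mul, mul_pureProj_mul_conjTranspose]
  have hF : ∀ ψ : Fin d → ℂ, nsq ψ = 1 → 0 ≤ f (diagOf ψ) := fun ψ hψ =>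
    hf0 _ (isDensityMatrix_diagonal (population_nonneg ψ) hψ)
  have hle := csInf_le (roofValues_bddBelow hF _)
    (sum_nsq_mul_mem_roofValues (fun ψ => f (diagOf ψ)) (s ×ˢ univ) φ hnorm)
  rw [← hstate] at hle
  refine (mul_le_mul_of_nonneg_left hle hx.le).trans (le_of_eq ?_)
  simp only [nsq_mul_diagOf_normalize, φ, population_smul, hsq, diagPerspective_smul,
    Finset.sum_product, mul_assoc, ← Finset.mul_sum]
  rw [mul_inv_cancel_left₀ hx.ne']

/-- if `f` is unitarily invariant and concave on density matrices, then the
convex-roof extension of `ψ ↦ f(Diag(λ(ψ)))` is an ensemble monotone for all states. -/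
theorem stmt_3 {d : ℕ} (hd : 1 ≤ d) (f : Matrix (Fin d) (Fin d) ℂ → ℝ)
    (hf0 : ∀ ρ, IsDensityMatrix ρ → 0 ≤ f ρ)
    (hE1 : ∀ ρ, IsDensityMatrix ρ → ∀ U ∈ Matrix.unitaryGroup (Fin d) ℂ,
      f (U * ρ * Uᴴ) = f ρ)
    (hE2 : ∀ ρ₁ ρ₂, IsDensityMatrix ρ₁ → IsDensityMatrix ρ₂ →
      ∀ t : ℝ, 0 ≤ t → t ≤ 1 →
        t * f ρ₁ + (1 - t) * f ρ₂ ≤ f (t • ρ₁ + (1 - t) • ρ₂))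
    (ρ : Matrix (Fin d) (Fin d) ℂ) (hρ : IsDensityMatrix ρ)
    (mJ mX : ℕ) (K : Fin mJ → Matrix (Fin d) (Fin d) ℂ)
    (hK : ∀ j, IsNumberShift (K j))
    (hKsum : ∑ j, (K j)ᴴ * K j = 1)
    (part : Fin mJ → Fin mX) :
    convexRoof (fun ψ => f (diagOf ψ)) ρ ≥
      ∑ x ∈ Finset.univ.filter (fun x => 0 < outProb K part ρ x),
        outProb K part ρ x * convexRoof (fun ψ => f (diagOf ψ)) (outState K part ρ x) := by
  refine le_csInf (roofValues_nonempty (fun ψ => f (diagOf ψ)) hρ) ?_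
  rintro r ⟨m, q, ψ, hq, -, hψ, rfl, rfl⟩
  have hnn : ∀ j i, 0 ≤ q i * diagPerspective f (population (K j *ᵥ ψ i)) := fun j i =>
    mul_nonneg (hq i) (diagPerspective_nonneg hf0 (population_nonneg _))
  calc _ ≤ ∑ x ∈ univ.filter fun x => 0 < outProb K part (∑ i, q i • pureProj (ψ i)) x,
          ∑ j ∈ univ.filter (fun j => part j = x),
            ∑ i, q i * diagPerspective f (population (K j *ᵥ ψ i)) :=
        Finset.sum_le_sum fun x hx =>
          outProb_mul_convexRoof_outState_le hf0 K part hq ψ (Finset.mem_filter.1 hx).2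
    _ ≤ ∑ x, ∑ j ∈ univ.filter (fun j => part j = x),
            ∑ i, q i * diagPerspective f (population (K j *ᵥ ψ i)) :=
        Finset.sum_le_sum_of_subset_of_nonneg (Finset.filter_subset _ _) fun x _ _ =>
          Finset.sum_nonneg fun j _ => Finset.sum_nonneg fun i _ => hnn j i
    _ = ∑ i, q i * ∑ j, diagPerspective f (population (K j *ᵥ ψ i)) := by
        rw [Finset.sum_fiberwise, Finset.sum_comm]
        simp only [Finset.mul_sum]
    _ ≤ ∑ i, q i * f (diagOf (ψ i)) := by
        refine Finset.sum_le_sum fun i _ => mul_le_mul_of_nonneg_left ?_ (hq i)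
        rw [← diagPerspective_population_of_nsq_eq_one f (hψ i)]
        exact sum_diagPerspective_mulVec_le hE1 hE2 hK hKsum (ψ i)
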